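/- Estimation error bound for the algebraic estimator: if ẏ(σ) = F(σ) + α u(σ) on [t-τ, t] with F continuous and |F(σ) - Φ| ≤ ε on that window for some constant Φ, then the estimator F_est(t) = -(6/τ³)∫₀^τ[(τ-2s)y(t-τ+s) + α s(τ-s)u(t-τ+s)]ds satisfies |F_est(t) - Φ| ≤ C·ε for an absolute constant C (one may take C = 3/2, coming from (6/τ³)∫₀^τ s(τ-s)... bounds on the kernel after integration by parts). -/

import Mathlib

open intervalIntegral

theorem algebraic_estimator_error_bound
    (τ α Φ ε t : ℝ) (hτ : 0 < τ) (hε : 0 ≤ ε)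
    (y u F : ℝ → ℝ)
    (hu : ContinuousOn u (Set.Icc (t - τ) t))
    (hF : ContinuousOn F (Set.Icc (t - τ) t))
    (hder : ∀ σ ∈ Set.Icc (t - τ) t, HasDerivAt y (F σ + α * u σ) σ)
    (hFΦ : ∀ σ ∈ Set.Icc (t - τ) t, |F σ - Φ| ≤ ε) :
    |(-(6 / τ ^ 3) *
        (∫ s in (0:ℝ)..τ,
          ((τ - 2 * s) * y (t - τ + s) + α * s * (τ - s) * u (t - τ + s))))
      - Φ| ≤ (3 / 2) * ε := by
  have hmaps : Set.MapsTo (fun s : ℝ => t - τ + s) (Set.Icc 0 τ) (Set.Icc (t - τ) t) := by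
    intro s hs
    constructor <;> linarith [hs.1, hs.2]
  have hsh : ContinuousOn (fun s : ℝ => t - τ + s) (Set.Icc 0 τ) := by fun_prop
  have hy : ContinuousOn y (Set.Icc (t - τ) t) :=
    fun σ hσ => (hder σ hσ).continuousAt.continuousWithinAt
  have hy' : ContinuousOn (fun s : ℝ => y (t - τ + s)) (Set.Icc 0 τ) := hy.comp hsh hmaps
  have hu' : ContinuousOn (fun s : ℝ => u (t - τ + s)) (Set.Icc 0 τ) := hu.comp hsh hmaps
  have hF' : ContinuousOn (fun s : ℝ => F (t - τ + s)) (Set.Icc 0 τ) := hF.comp hsh hmaps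
  have hA : IntervalIntegrable (fun s : ℝ =>
      (τ - 2 * s) * y (t - τ + s) + α * s * (τ - s) * u (t - τ + s))
      MeasureTheory.volume 0 τ := by
    apply ContinuousOn.intervalIntegrable
    rw [Set.uIcc_of_le hτ.le]
    exact ((by fun_prop : ContinuousOn (fun s : ℝ => τ - 2 * s) (Set.Icc 0 τ)).mul hy').add
      ((by fun_prop : ContinuousOn (fun s : ℝ => α * s * (τ - s)) (Set.Icc 0 τ)).mul hu')
  have hB : IntervalIntegrable (fun s : ℝ => s * (τ - s) * (F (t - τ + s) - Φ))
      MeasureTheory.volume 0 τ := by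
    apply ContinuousOn.intervalIntegrable
    rw [Set.uIcc_of_le hτ.le]
    exact (by fun_prop : ContinuousOn (fun s : ℝ => s * (τ - s)) (Set.Icc 0 τ)).mul
      (hF'.sub continuousOn_const)
  -- integration by parts, through an explicit antiderivative
  have hFTC := integral_eq_sub_of_hasDerivAt (a := 0) (b := τ)
    (f := fun s : ℝ => s * (τ - s) * y (t - τ + s) - Φ * (τ * s ^ 2 / 2 - s ^ 3 / 3))
    (fun s hs => by
      rw [Set.uIcc_of_le hτ.le] at hs
      have h1 : HasDerivAt (fun s : ℝ => y (t - τ + s))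
          (F (t - τ + s) + α * u (t - τ + s)) s := by
        exact (hder _ (hmaps hs)).comp_const_add (t - τ) s
      have h2 : HasDerivAt (fun s : ℝ => s * (τ - s)) (τ - 2 * s) s := by
        refine ((hasDerivAt_id' s).mul ((hasDerivAt_id' s).const_sub τ)).congr_deriv ?_
        ring
      have h3 : HasDerivAt (fun s : ℝ => Φ * (τ * s ^ 2 / 2 - s ^ 3 / 3))
          (Φ * (s * (τ - s))) s := by
        refine (((((hasDerivAt_pow 2 s).const_mul τ).div_const 2).sub
          ((hasDerivAt_pow 3 s).div_const 3)).const_mul Φ).congr_deriv ?_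
        push_cast
        ring
      have h4 := (h2.mul h1).sub h3
      refine h4.congr_deriv (g' := ((τ - 2 * s) * y (t - τ + s)
        + α * s * (τ - s) * u (t - τ + s)) + s * (τ - s) * (F (t - τ + s) - Φ)) ?_
      ring)
    (hA.add hB)
  rw [integral_add hA hB] at hFTC
  have hbound : |∫ s in (0:ℝ)..τ, s * (τ - s) * (F (t - τ + s) - Φ)|
      ≤ τ ^ 2 / 4 * ε * |τ - 0| := by
    rw [← Real.norm_eq_abs (∫ s in (0:ℝ)..τ, s * (τ - s) * (F (t - τ + s) - Φ))]
    refine norm_integral_le_of_norm_le_const (fun s hs => ?_)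
    rw [Set.uIoc_of_le hτ.le] at hs
    have hs' : s ∈ Set.Icc 0 τ := ⟨hs.1.le, hs.2⟩
    rw [Real.norm_eq_abs, abs_mul,
      abs_of_nonneg (mul_nonneg hs'.1 (sub_nonneg.2 hs'.2))]
    refine mul_le_mul ?_ (hFΦ _ (hmaps hs')) (abs_nonneg _) (by positivity)
    nlinarith [sq_nonneg (τ - 2 * s)]
  rw [sub_zero, abs_of_pos hτ] at hbound
  generalize (∫ s in (0:ℝ)..τ, s * (τ - s) * (F (t - τ + s) - Φ)) = B at *
  generalize (∫ s in (0:ℝ)..τ,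
    ((τ - 2 * s) * y (t - τ + s) + α * s * (τ - s) * u (t - τ + s))) = A at *
  have hAe : A = -Φ * τ ^ 3 / 6 - B := by
    simp only [sub_self] at hFTC
    linear_combination hFTC
  have e : -(6 / τ ^ 3) * A - Φ = 6 / τ ^ 3 * B := by
    rw [hAe]
    field_simp
    ring
  rw [e, abs_mul, abs_of_pos (by positivity)]
  calc 6 / τ ^ 3 * |B| ≤ 6 / τ ^ 3 * (τ ^ 2 / 4 * ε * τ) := by gcongr
    _ = 3 / 2 * ε := by
      field_simp
      ring
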